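/- Let d ≥ 5 be an odd integer, σ > 0, and z ∈ ℝ^{d−1} with z ≠ 0. Then ∫_{ℝ^{d−1}} φ_{d−1}(z − ζ; σ² I_{d−1}) · ‖ζ‖^{−(d−3)} dζ = ‖z‖^{3−d} · ( 1 − e^{−‖z‖²/(2σ²)} · Σ_{k=0}^{(d−5)/2} (‖z‖²/(2σ²))^k / k! ). (This evaluates the marginal density m_{π₀}(z, σ²) of the harmonic prior π₀(ζ) = ‖ζ‖^{−(d−3)} on ℝ^{d−1}, equivalently σ^{3−d}·E[T^{(3−d)/2}] for T a noncentral chi-square variable with d−1 degrees of freedom and noncentrality ‖z‖²/σ².) -/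

import Mathlib

open MeasureTheory Matrix Real

/-- The centered `d`-variate normal density `φ_d(z; Σ)` with covariance matrix `S`. -/
noncomputable def mvn (d : ℕ) (S : Matrix (Fin d) (Fin d) ℝ) (z : Fin d → ℝ) : ℝ :=
  (2 * π) ^ (-(d : ℝ) / 2) * S.det ^ (-(1 : ℝ) / 2) * Real.exp (-(z ⬝ᵥ S⁻¹ *ᵥ z) / 2)

open Set Filter Topology

theorem mvn_smul_one (m : ℕ) {s : ℝ} (hs : 0 < s) (z : Fin (2 * m) → ℝ) :
    mvn (2 * m) (s • (1 : Matrix (Fin (2 * m)) (Fin (2 * m)) ℝ)) z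
      = ((2 * π * s) ^ m)⁻¹ * exp (-(z ⬝ᵥ z) / (2 * s)) := by
  have hinv : (s • (1 : Matrix (Fin (2 * m)) (Fin (2 * m)) ℝ))⁻¹ = s⁻¹ • 1 := by
    apply Matrix.inv_eq_left_inv
    simp [smul_smul, hs.ne']
  have hpi : (2 * π) ^ (-((2 * m : ℕ) : ℝ) / 2) = ((2 * π) ^ m)⁻¹ := by
    rw [← rpow_natCast, ← rpow_neg (by positivity)]
    congr 1
    push_cast
    ring
  have hdet : (s ^ (2 * m)) ^ (-(1 : ℝ) / 2) = (s ^ m)⁻¹ := by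
    rw [← rpow_natCast, ← rpow_mul hs.le, ← rpow_natCast, ← rpow_neg hs.le]
    congr 1
    push_cast
    ring
  rw [mvn, hinv, Matrix.det_smul, Matrix.det_one, mul_one, Fintype.card_fin, hpi, hdet,
    Matrix.smul_mulVec, Matrix.one_mulVec, dotProduct_smul, smul_eq_mul, mul_pow _ s, mul_inv]
  congr 2
  field_simp

theorem gaussian_mul_gaussian_eq {s t : ℝ} (hs : 0 < s) (ht : 0 ≤ t) (a x : ℝ) :
    exp (-(a - x) ^ 2 / (2 * s) - t * x ^ 2)
      = exp (-(t / (1 + 2 * s * t)) * a ^ 2) *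
        exp (-((1 + 2 * s * t) / (2 * s)) * (x - a / (1 + 2 * s * t)) ^ 2) := by
  have h : 1 + 2 * s * t ≠ 0 := by positivity
  rw [← exp_add]
  congr 1
  field_simp
  ring

theorem integrable_gaussian_mul_gaussian {s t : ℝ} (hs : 0 < s) (ht : 0 ≤ t) (a : ℝ) :
    Integrable fun x : ℝ => exp (-(a - x) ^ 2 / (2 * s) - t * x ^ 2) := by
  simp_rw [gaussian_mul_gaussian_eq hs ht]
  exact ((integrable_exp_neg_mul_sq (by positivity)).comp_sub_right _).const_mul _

theorem integral_gaussian_mul_gaussian {s t : ℝ} (hs : 0 < s) (ht : 0 ≤ t) (a : ℝ) :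
    ∫ x : ℝ, exp (-(a - x) ^ 2 / (2 * s) - t * x ^ 2)
      = exp (-(t / (1 + 2 * s * t)) * a ^ 2) * √(2 * π * s / (1 + 2 * s * t)) := by
  simp_rw [gaussian_mul_gaussian_eq hs ht]
  rw [integral_const_mul, integral_sub_right_eq_self
    (fun x => exp (-((1 + 2 * s * t) / (2 * s)) * x ^ 2)), integral_gaussian]
  congr 2
  field_simp

theorem exp_dotProduct_eq_prod {n : ℕ} (s t : ℝ) (z x : Fin n → ℝ) :
    exp (-((z - x) ⬝ᵥ (z - x)) / (2 * s) - t * (x ⬝ᵥ x))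
      = ∏ i, exp (-(z i - x i) ^ 2 / (2 * s) - t * x i ^ 2) := by
  rw [← exp_sum]
  congr 1
  simp only [dotProduct, Pi.sub_apply, Finset.sum_sub_distrib, ← Finset.mul_sum, ← Finset.sum_div,
    Finset.sum_neg_distrib, pow_two]

theorem integrable_exp_dotProduct {n : ℕ} {s t : ℝ} (hs : 0 < s) (ht : 0 ≤ t) (z : Fin n → ℝ) :
    Integrable fun x : Fin n → ℝ =>
      exp (-((z - x) ⬝ᵥ (z - x)) / (2 * s) - t * (x ⬝ᵥ x)) := by
  simp_rw [exp_dotProduct_eq_prod]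
  exact Integrable.fintype_prod fun i => integrable_gaussian_mul_gaussian hs ht (z i)

theorem integral_exp_dotProduct {m : ℕ} {s t : ℝ} (hs : 0 < s) (ht : 0 ≤ t)
    (z : Fin (2 * m) → ℝ) :
    ∫ x : Fin (2 * m) → ℝ, exp (-((z - x) ⬝ᵥ (z - x)) / (2 * s) - t * (x ⬝ᵥ x))
      = exp (-(t / (1 + 2 * s * t)) * (z ⬝ᵥ z)) * (2 * π * s / (1 + 2 * s * t)) ^ m := by
  simp_rw [exp_dotProduct_eq_prod]
  rw [integral_fintype_prod_volume_eq_prod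
    (fun i (x : ℝ) => exp (-(z i - x) ^ 2 / (2 * s) - t * x ^ 2))]
  simp_rw [integral_gaussian_mul_gaussian hs ht]
  rw [Finset.prod_mul_distrib, ← exp_sum, Finset.prod_const, Finset.card_univ, Fintype.card_fin,
    pow_mul, sq_sqrt (by positivity)]
  simp only [dotProduct, ← Finset.mul_sum, pow_two]

theorem hasDerivAt_neg_exp_neg_mul_sum (p : ℕ) (x : ℝ) :
    HasDerivAt (fun x : ℝ => -(exp (-x) * ∑ k ∈ Finset.range (p + 1), x ^ k / (k.factorial : ℝ)))
      (exp (-x) * (x ^ p / (p.factorial : ℝ))) x := by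
  have hexp : HasDerivAt (fun x : ℝ => exp (-x)) (-exp (-x)) x := by
    simpa using (hasDerivAt_neg x).exp
  induction p with
  | zero => simpa using hexp.fun_neg
  | succ p ih =>
    have hpow : HasDerivAt (fun x : ℝ => x ^ (p + 1) / ((p + 1).factorial : ℝ))
        (x ^ p / (p.factorial : ℝ)) x := by
      refine ((hasDerivAt_pow (p + 1) x).div_const ((p + 1).factorial : ℝ)).congr_deriv ?_
      have := Nat.factorial_ne_zero p
      rw [Nat.factorial_succ]
      push_cast
      field_simp
    simp_rw [Finset.sum_range_succ _ (p + 1), mul_add, neg_add]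
    refine (ih.fun_add (hexp.fun_mul hpow).fun_neg).congr_deriv ?_
    ring

/-- The Laplace-type integral produced by mixing Gaussians, with its integrability: the
substitution `u = t / (1 + 2 s t)` turns it into an incomplete Gamma integral. -/
theorem integrableOn_and_integral_mixture (p : ℕ) {s r : ℝ} (hs : 0 < s) (hr : 0 < r) :
    IntegrableOn (fun t : ℝ => t ^ p * (exp (-(t / (1 + 2 * s * t)) * r) *
        (2 * π * s / (1 + 2 * s * t)) ^ (p + 2))) (Ioi 0) ∧
    ∫ t in Ioi (0 : ℝ), t ^ p * (exp (-(t / (1 + 2 * s * t)) * r) *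
        (2 * π * s / (1 + 2 * s * t)) ^ (p + 2))
      = (p.factorial : ℝ) * (2 * π * s) ^ (p + 2) * ((r ^ (p + 1))⁻¹ *
        (1 - exp (-r / (2 * s)) *
          ∑ k ∈ Finset.range (p + 1), (r / (2 * s)) ^ k / (k.factorial : ℝ))) := by
  set G : ℝ → ℝ := fun x =>
    -(exp (-x) * ∑ k ∈ Finset.range (p + 1), x ^ k / (k.factorial : ℝ)) with hG
  set C : ℝ := (p.factorial : ℝ) * (2 * π * s) ^ (p + 2) * (r ^ (p + 1))⁻¹ with hC
  have hGc : Continuous G := by fun_prop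
  have hderiv : ∀ t ∈ Ici (0 : ℝ), HasDerivAt (fun t => C * G (t / (1 + 2 * s * t) * r))
      (t ^ p * (exp (-(t / (1 + 2 * s * t)) * r) * (2 * π * s / (1 + 2 * s * t)) ^ (p + 2))) t := by
    intro t ht
    have ht : 0 ≤ t := ht
    have h1 : 1 + 2 * s * t ≠ 0 := by positivity
    have hden : HasDerivAt (fun t => 1 + 2 * s * t) (2 * s) t := by
      simpa using ((hasDerivAt_id t).const_mul (2 * s)).const_add 1
    have hu : HasDerivAt (fun t => t / (1 + 2 * s * t) * r) (r / (1 + 2 * s * t) ^ 2) t := by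
      refine (((hasDerivAt_id' t).fun_div hden h1).mul_const r).congr_deriv ?_
      field_simp
      ring
    refine (((hasDerivAt_neg_exp_neg_mul_sum p _).comp t hu).const_mul C).congr_deriv ?_
    have := Nat.factorial_ne_zero p
    rw [hC, neg_mul, mul_pow _ r, div_pow, div_pow, pow_succ r]
    field_simp
    ring
  have hlim : Tendsto (fun t => C * G (t / (1 + 2 * s * t) * r)) atTop
      (𝓝 (C * G (r / (2 * s)))) := by
    have hu : Tendsto (fun t : ℝ => r / (t⁻¹ + 2 * s)) atTop (𝓝 (r / (0 + 2 * s))) :=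
      tendsto_const_nhds.div (tendsto_inv_atTop_zero.add_const _) (by positivity)
    rw [zero_add] at hu
    refine (((hGc.tendsto _).comp hu).const_mul C).congr' ?_
    filter_upwards [eventually_gt_atTop 0] with t ht
    simp only [Function.comp]
    congr 2
    field_simp
  have hnonneg : ∀ t ∈ Ioi (0 : ℝ), 0 ≤ t ^ p * (exp (-(t / (1 + 2 * s * t)) * r) *
      (2 * π * s / (1 + 2 * s * t)) ^ (p + 2)) := by
    intro t ht
    have ht : 0 < t := ht
    positivity
  refine ⟨integrableOn_Ioi_deriv_of_nonneg' hderiv hnonneg hlim, ?_⟩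
  rw [integral_Ioi_of_hasDerivAt_of_nonneg' hderiv hnonneg hlim]
  have hG0 : G 0 = -1 := by
    simp only [hG, Finset.sum_range_succ']
    simp
  simp only [zero_div, zero_mul, hG0]
  simp only [hG, hC, neg_div]
  ring

theorem integral_pow_mul_exp_neg_mul_Ioi (p : ℕ) {A : ℝ} (hA : 0 < A) :
    ∫ t in Ioi (0 : ℝ), t ^ p * exp (-(t * A)) = (p.factorial : ℝ) * (A ^ (p + 1))⁻¹ := by
  have h := integral_rpow_mul_exp_neg_mul_Ioi (a := (p : ℝ) + 1) (by positivity) hA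
  rw [Gamma_nat_eq_factorial, ← Nat.cast_succ, rpow_natCast] at h
  simp only [Nat.cast_succ, add_sub_cancel_right, rpow_natCast] at h
  simp_rw [mul_comm _ A, h]
  simp [mul_comm]

theorem integral_exp_mul_inv_pow (p : ℕ) {s : ℝ} (hs : 0 < s) (z : Fin (2 * (p + 2)) → ℝ)
    (hz : z ≠ 0) :
    ∫ x : Fin (2 * (p + 2)) → ℝ,
        exp (-((z - x) ⬝ᵥ (z - x)) / (2 * s)) * ((x ⬝ᵥ x) ^ (p + 1))⁻¹
      = (2 * π * s) ^ (p + 2) * (((z ⬝ᵥ z) ^ (p + 1))⁻¹ *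
        (1 - exp (-(z ⬝ᵥ z) / (2 * s)) *
          ∑ k ∈ Finset.range (p + 1), ((z ⬝ᵥ z) / (2 * s)) ^ k / (k.factorial : ℝ))) := by
  have hpos : ∀ x : Fin (2 * (p + 2)) → ℝ, x ≠ 0 → 0 < x ⬝ᵥ x := fun x hx =>
    lt_of_le_of_ne (Finset.sum_nonneg fun i _ => mul_self_nonneg (x i))
      fun h => hx (dotProduct_self_eq_zero.mp h.symm)
  obtain ⟨hmix, hval⟩ := integrableOn_and_integral_mixture p hs (hpos z hz)
  set F : (Fin (2 * (p + 2)) → ℝ) → ℝ → ℝ := fun x t =>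
    t ^ p * exp (-((z - x) ⬝ᵥ (z - x)) / (2 * s) - t * (x ⬝ᵥ x)) with hF
  have hFc : Continuous (Function.uncurry F) := by
    simp only [hF, Function.uncurry_def, dotProduct]
    fun_prop
  have hinner : ∀ t ∈ Ioi (0 : ℝ), ∫ x, F x t = t ^ p * (exp (-(t / (1 + 2 * s * t)) * (z ⬝ᵥ z)) *
      (2 * π * s / (1 + 2 * s * t)) ^ (p + 2)) := by
    intro t ht
    rw [hF, integral_const_mul, integral_exp_dotProduct hs (le_of_lt ht)]
  have hFint : Integrable (Function.uncurry F) (volume.prod (volume.restrict (Ioi 0))) := by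
    rw [integrable_prod_iff' hFc.aestronglyMeasurable]
    constructor
    · filter_upwards [ae_restrict_mem measurableSet_Ioi] with t ht
      exact (integrable_exp_dotProduct hs (le_of_lt ht) z).const_mul (t ^ p)
    · refine hmix.congr ?_
      filter_upwards [ae_restrict_mem measurableSet_Ioi] with t ht
      rw [← hinner t ht]
      refine integral_congr_ae (ae_of_all _ fun x => ?_)
      have ht : 0 < t := ht
      have : 0 ≤ F x t := by simp only [hF]; positivity
      simp [abs_of_nonneg this]
  have hswap := integral_integral_swap hFint
  rw [setIntegral_congr_fun measurableSet_Ioi hinner, hval] at hswap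
  have hfac : (p.factorial : ℝ) ≠ 0 := by positivity
  refine mul_left_cancel₀ hfac ?_
  rw [← mul_assoc, ← hswap, ← integral_const_mul]
  refine integral_congr_ae ?_
  filter_upwards [Measure.ae_ne volume 0] with x hx
  simp only [hF, sub_eq_add_neg (_ / _), exp_add]
  rw [mul_left_comm, ← integral_pow_mul_exp_neg_mul_Ioi p (hpos x hx), ← integral_const_mul]
  refine integral_congr_ae (ae_of_all _ fun t => ?_)
  simp only
  ring

/-- closed form for the marginal density of the harmonic prior
`π₀(ζ) = ‖ζ‖^{−(d−3)}` on `ℝ^{d−1}` for odd `d ≥ 5`: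
`∫ φ_{d−1}(z − ζ; σ²I) ‖ζ‖^{−(d−3)} dζ
  = ‖z‖^{3−d} (1 − e^{−‖z‖²/(2σ²)} ∑_{k=0}^{(d−5)/2} (‖z‖²/(2σ²))^k/k!)`. -/
theorem harmonic_prior_marginal
    (d : ℕ) (hd : 5 ≤ d) (hodd : Odd d) (σ : ℝ) (hσ : 0 < σ)
    (z : Fin (d - 1) → ℝ) (hz : z ≠ 0) :
    ∫ ζ : Fin (d - 1) → ℝ,
        mvn (d - 1) (σ ^ 2 • (1 : Matrix (Fin (d - 1)) (Fin (d - 1)) ℝ)) (z - ζ) *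
          Real.sqrt (ζ ⬝ᵥ ζ) ^ (-((d : ℝ) - 3))
      = Real.sqrt (z ⬝ᵥ z) ^ ((3 : ℝ) - d) *
          (1 - Real.exp (-(z ⬝ᵥ z) / (2 * σ ^ 2)) *
            ∑ k ∈ Finset.range ((d - 5) / 2 + 1),
              ((z ⬝ᵥ z) / (2 * σ ^ 2)) ^ k / (Nat.factorial k : ℝ)) := by
  obtain ⟨p, rfl⟩ : ∃ p, d = 2 * p + 5 := by
    obtain ⟨k, rfl⟩ := hodd
    exact ⟨k - 2, by omega⟩
  have hpow : ∀ x : Fin (2 * (p + 2)) → ℝ, ∀ e : ℝ, e = -(2 * ((p : ℝ) + 1)) →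
      √(x ⬝ᵥ x) ^ e = ((x ⬝ᵥ x) ^ (p + 1))⁻¹ := by
    rintro x e rfl
    have hx : 0 ≤ x ⬝ᵥ x := Finset.sum_nonneg fun i _ => mul_self_nonneg (x i)
    rw [rpow_neg (sqrt_nonneg _), rpow_mul (sqrt_nonneg _), rpow_two, sq_sqrt hx,
      ← Nat.cast_succ, rpow_natCast]
  have hs : 0 < σ ^ 2 := by positivity
  have hrange : (2 * p + 5 - 5) / 2 + 1 = p + 1 := by omega
  change Fin (2 * (p + 2)) → ℝ at z
  change ∫ ζ : Fin (2 * (p + 2)) → ℝ, mvn (2 * (p + 2))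
    (σ ^ 2 • (1 : Matrix (Fin (2 * (p + 2))) (Fin (2 * (p + 2))) ℝ)) (z - ζ) * _ = _
  rw [hrange, hpow z _ (by push_cast; ring)]
  simp_rw [mvn_smul_one (p + 2) hs, hpow _ (-(((2 * p + 5 : ℕ) : ℝ) - 3)) (by push_cast; ring),
    mul_assoc]
  rw [integral_const_mul, integral_exp_mul_inv_pow p hs z hz]
  simp_rw [mul_assoc]
  rw [← mul_assoc, inv_mul_cancel₀ (by positivity), one_mul]
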